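/- Let B be a real Banach space whose norm satisfies condition (*) with parameters s ∈ [2,∞) and m > 0, and let T : B → B be a bounded linear operator with ‖Tf‖ ≤ ‖f‖ for all f ∈ B. Then for every integer r ≥ 1 and every f ∈ B the series ∑_{j=0}^∞ 2^{−jrs} ‖(T^{2^j}−I)^{r+1} f‖^s converges and ‖(T−I)^r f‖ ≥ (m^{1/s}/2) ( ∑_{j=0}^∞ 2^{−jrs} ‖(T^{2^j}−I)^{r+1} f‖^s )^{1/s}. -/

import Mathlib

/-- If `S` is a contraction then so is `((S + 1) / 2) ^ n`, stated without the division. -/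
theorem norm_add_one_pow_apply_le {B : Type*} [NormedAddCommGroup B] [NormedSpace ℝ B]
    (S : B →L[ℝ] B) (hS : ∀ f : B, ‖S f‖ ≤ ‖f‖) (n : ℕ) (f : B) :
    ‖((S + 1 : B →L[ℝ] B) ^ n) f‖ ≤ 2 ^ n * ‖f‖ := by
  induction n with
  | zero => simp
  | succ n ih =>
    rw [pow_succ', mul_apply_eq_comp]
    set g := ((S + 1 : B →L[ℝ] B) ^ n) f
    have h : ‖(S + 1 : B →L[ℝ] B) g‖ ≤ ‖S g‖ + ‖g‖ := norm_add_le (S g) g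
    have := hS g
    rw [pow_succ]
    linarith

theorem norm_pow_apply_le {B : Type*} [NormedAddCommGroup B] [NormedSpace ℝ B]
    (S : B →L[ℝ] B) (hS : ∀ f : B, ‖S f‖ ≤ ‖f‖) (n : ℕ) (f : B) :
    ‖(S ^ n) f‖ ≤ ‖f‖ := by
  induction n with
  | zero => simp
  | succ n ih =>
    rw [pow_succ', mul_apply_eq_comp]
    exact (hS _).trans ih

/-- The one-step inequality behind the telescoping argument: passing from the contraction `S`
to `S ^ 2`. -/
theorem norm_sq_sub_one_pow_rpow_add_le {B : Type*} [NormedAddCommGroup B] [NormedSpace ℝ B]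
    {s m : ℝ} (hs : 0 < s) (hm : 0 < m)
    (hstar : ∀ F G : B, (‖F‖ ^ s + m * ‖G‖ ^ s) ^ (1 / s) ≤ max ‖F + G‖ ‖F - G‖)
    (S : B →L[ℝ] B) (hS : ∀ f : B, ‖S f‖ ≤ ‖f‖) {r : ℕ} (hr : 1 ≤ r) (f : B) :
    (2 : ℝ) ^ (-(r : ℝ) * s) * ‖((S ^ 2 - 1 : B →L[ℝ] B) ^ r) f‖ ^ s +
      m / 2 ^ s * ‖((S - 1 : B →L[ℝ] B) ^ (r + 1)) f‖ ^ s ≤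
      ‖((S - 1 : B →L[ℝ] B) ^ r) f‖ ^ s := by
  obtain ⟨k, rfl⟩ : ∃ k, r = k + 1 := ⟨r - 1, by omega⟩
  set g := ((S - 1 : B →L[ℝ] B) ^ (k + 1)) f with hg
  have hfac : (S ^ 2 - 1 : B →L[ℝ] B) ^ (k + 1) =
      (S + 1) ^ k * ((S + 1) * (S - 1) ^ (k + 1)) := by
    have hc : Commute (S + 1) (S - 1) :=
      ((Commute.refl S).add_left (Commute.one_left S)).sub_right (Commute.one_right _)
    have h : S ^ 2 - 1 = (S + 1) * (S - 1) := by noncomm_ring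
    rw [h, hc.mul_pow, pow_succ (S + 1) k, mul_assoc]
  have h1 : ‖((S ^ 2 - 1 : B →L[ℝ] B) ^ (k + 1)) f‖ ≤ 2 ^ k * ‖S g + g‖ := by
    rw [hfac]
    exact norm_add_one_pow_apply_le S hS k _
  have h2 : ((S - 1 : B →L[ℝ] B) ^ (k + 1 + 1)) f = S g - g := by
    rw [pow_succ']; rfl
  have h3 := hstar ((1 / 2 : ℝ) • (S g + g)) ((1 / 2 : ℝ) • (S g - g))
  have e1 : (1 / 2 : ℝ) • (S g + g) + (1 / 2 : ℝ) • (S g - g) = S g := by module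
  have e2 : (1 / 2 : ℝ) • (S g + g) - (1 / 2 : ℝ) • (S g - g) = g := by module
  rw [e1, e2, max_eq_right (hS g), norm_smul, norm_smul, one_div s,
    Real.rpow_inv_le_iff_of_pos (by positivity) (by positivity) hs] at h3
  rw [h2]
  refine le_trans (add_le_add ?_ (le_of_eq ?_)) h3
  · have h4 : (2 : ℝ) ^ (-((k + 1 : ℕ) : ℝ) * s) = ((2 ^ (k + 1))⁻¹ : ℝ) ^ s := by
      rw [Real.rpow_mul (by norm_num), Real.rpow_neg (by norm_num), Real.rpow_natCast]
    rw [h4, ← Real.mul_rpow (by positivity) (by positivity)]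
    refine Real.rpow_le_rpow (by positivity) ?_ hs.le
    calc ((2 ^ (k + 1))⁻¹ : ℝ) * ‖((S ^ 2 - 1 : B →L[ℝ] B) ^ (k + 1)) f‖
        ≤ (2 ^ (k + 1))⁻¹ * (2 ^ k * ‖S g + g‖) := by gcongr
      _ = ‖(1 / 2 : ℝ)‖ * ‖S g + g‖ := by
        rw [Real.norm_of_nonneg (by norm_num)]
        field_simp
        ring
  · rw [Real.mul_rpow (by positivity) (by positivity), Real.norm_of_nonneg (by norm_num),
      Real.div_rpow (by norm_num) (by norm_num), Real.one_rpow]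
    ring


/-- If the norm of a Banach space `B` satisfies condition (*) with parameters
`s ∈ [2,∞)` and `m > 0`, and `T : B → B` is a bounded linear contraction, then for every
integer `r ≥ 1` and every `f ∈ B` the series `∑_{j=0}^∞ 2^{−jrs} ‖(T^{2^j}−I)^{r+1} f‖^s`
converges and `‖(T−I)^r f‖ ≥ (m^{1/s}/2) (∑_{j=0}^∞ 2^{−jrs} ‖(T^{2^j}−I)^{r+1} f‖^s)^{1/s}`. -/
theorem stmt1 {B : Type*} [NormedAddCommGroup B] [NormedSpace ℝ B] [CompleteSpace B]
    (s m : ℝ) (hs : 2 ≤ s) (hm : 0 < m)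
    (hstar : ∀ F G : B, (‖F‖ ^ s + m * ‖G‖ ^ s) ^ (1 / s) ≤ max ‖F + G‖ ‖F - G‖)
    (T : B →L[ℝ] B) (hT : ∀ f : B, ‖T f‖ ≤ ‖f‖)
    (r : ℕ) (hr : 1 ≤ r) (f : B) :
    Summable (fun j : ℕ =>
      (2 : ℝ) ^ (-(j : ℝ) * r * s) * ‖((T ^ (2 ^ j) - 1 : B →L[ℝ] B) ^ (r + 1)) f‖ ^ s) ∧
    m ^ (1 / s) / 2 *
        (∑' j : ℕ,
          (2 : ℝ) ^ (-(j : ℝ) * r * s) * ‖((T ^ (2 ^ j) - 1 : B →L[ℝ] B) ^ (r + 1)) f‖ ^ s)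
          ^ (1 / s)
      ≤ ‖((T - 1 : B →L[ℝ] B) ^ r) f‖ := by
  have hs0 : 0 < s := by linarith
  set t : ℕ → ℝ := fun j =>
    (2 : ℝ) ^ (-(j : ℝ) * r * s) * ‖((T ^ (2 ^ j) - 1 : B →L[ℝ] B) ^ (r + 1)) f‖ ^ s with ht
  have ht0 : ∀ j, 0 ≤ t j := fun j => by positivity
  set A : ℕ → ℝ := fun j =>
    (2 : ℝ) ^ (-(j : ℝ) * r * s) * ‖((T ^ (2 ^ j) - 1 : B →L[ℝ] B) ^ r) f‖ ^ s with hA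
  have hA0 : A 0 = ‖((T - 1 : B →L[ℝ] B) ^ r) f‖ ^ s := by simp [hA]
  have hc : 0 < m / (2 : ℝ) ^ s := by positivity
  have hstep : ∀ j, A (j + 1) + m / 2 ^ s * t j ≤ A j := fun j => by
    have h := norm_sq_sub_one_pow_rpow_add_le hs0 hm hstar (T ^ (2 ^ j))
      (norm_pow_apply_le T hT _) hr f
    rw [← pow_mul, ← pow_succ] at h
    have h' := mul_le_mul_of_nonneg_left h
      (Real.rpow_nonneg (zero_le_two (α := ℝ)) (-(j : ℝ) * r * s))
    have e : (2 : ℝ) ^ (-((j + 1 : ℕ) : ℝ) * r * s) =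
        2 ^ (-(j : ℝ) * r * s) * 2 ^ (-(r : ℝ) * s) := by
      rw [← Real.rpow_add (by norm_num)]
      congr 1
      push_cast
      ring
    simp only [hA, ht]
    rw [e]
    linarith
  have hsum : ∀ n, A n + m / 2 ^ s * ∑ j ∈ Finset.range n, t j ≤ A 0 := fun n => by
    induction n with
    | zero => simp
    | succ n ih =>
      rw [Finset.sum_range_succ, mul_add]
      linarith [hstep n]
  have hbound : ∀ n, ∑ j ∈ Finset.range n, t j ≤ A 0 / (m / 2 ^ s) := fun n => by
    rw [le_div_iff₀' hc]
    have : 0 ≤ A n := by positivity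
    linarith [hsum n]
  refine ⟨summable_of_sum_range_le ht0 hbound, ?_⟩
  have htsum : ∑' j, t j ≤ A 0 / (m / 2 ^ s) := Real.tsum_le_of_sum_range_le ht0 hbound
  have htsum0 : 0 ≤ ∑' j, t j := tsum_nonneg ht0
  have e : m ^ (1 / s) / 2 = (m / 2 ^ s) ^ (1 / s) := by
    rw [Real.div_rpow hm.le (by positivity), ← Real.rpow_mul (by norm_num),
      mul_one_div_cancel hs0.ne', Real.rpow_one]
  rw [e, ← Real.mul_rpow hc.le htsum0, one_div,
    Real.rpow_inv_le_iff_of_pos (by positivity) (by positivity) hs0, ← hA0]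
  exact (le_div_iff₀' hc).1 htsum
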